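/- arXiv:2105.00481 — 5 statements merged into one kernel-verified Lean document; each statement's English description precedes it below -/
import Mathlib

section
/- Let k, s, p be positive integers with n ≥ 4k²s and p ≥ n/k. Then the maximum of p·|ℬ₀| + |ℬ₁| + … + |ℬ_s| over all nested overlapping sequences ℬ₀ ⊆ ℬ₁ ⊆ … ⊆ ℬ_s of families of k-element subsets of [n] = {1,…,n} equals (p+s)·( C(n,k) − C(n−s,k) ), where C(a,b) denotes the binomial coefficient. -/
/-- A sequence of families `𝒜 0, …, 𝒜 (m-1)` of subsets of the ground type `α`
admits a rainbow matching of size `t` if one can pick `t` distinct families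
(in increasing order of index) and pairwise disjoint members, one from each. -/
def HasRainbowMatching {α : Type*} [DecidableEq α] {m : ℕ}
    (𝒜 : Fin m → Finset (Finset α)) (t : ℕ) : Prop :=
  ∃ (idx : Fin t → Fin m) (f : Fin t → Finset α),
    StrictMono idx ∧ (∀ a, f a ∈ 𝒜 (idx a)) ∧
    ∀ a b, a ≠ b → Disjoint (f a) (f b)

open Finset

/-- One can pick pairwise disjoint members, one from each family. -/
def HasFullMatching {α : Type*} {m : ℕ} (B : Fin m → Finset (Finset α)) : Prop :=
  ∃ f : Fin m → Finset α, (∀ i, f i ∈ B i) ∧ ∀ i j, i ≠ j → Disjoint (f i) (f j)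

lemma hasRainbowMatching_iff_hasFullMatching {α : Type*} [DecidableEq α] {m : ℕ}
    (B : Fin m → Finset (Finset α)) : HasRainbowMatching B m ↔ HasFullMatching B := by
  constructor
  · rintro ⟨idx, f, hidx, hf, hd⟩
    have hid : idx = id := hidx.eq_id
    subst hid
    exact ⟨f, hf, hd⟩
  · rintro ⟨f, hf, hd⟩
    exact ⟨id, f, strictMono_id, hf, hd⟩

section Shifting

variable {α : Type*} [DecidableEq α]

lemma map_swap_eq_union_sdiff {x y : α} (A : Finset α) (hx : x ∈ A) (hy : y ∉ A) :
    A.map (Equiv.swap x y).toEmbedding = (A ∪ {y}) \ {x} := by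
  ext a
  simp only [mem_map_equiv, Equiv.symm_swap, mem_sdiff, mem_union, mem_singleton,
    Equiv.swap_apply_def]
  split_ifs with h1 h2 <;> simp_all

lemma map_swap_eq_self {x y : α} (A : Finset α) (hx : x ∉ A) (hy : y ∉ A) :
    A.map (Equiv.swap x y).toEmbedding = A := by
  ext a
  simp only [mem_map_equiv, Equiv.symm_swap, Equiv.swap_apply_def]
  split_ifs with h1 h2 <;> simp_all

lemma HasFullMatching.of_compression {m : ℕ} {B : Fin m → Finset (Finset α)} {x y : α}
    (h : HasFullMatching fun i => UV.compression {y} {x} (B i)) : HasFullMatching B := by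
  obtain ⟨f, hf, hd⟩ := h
  by_cases hall : ∀ i, f i ∈ B i
  · exact ⟨f, hall, hd⟩
  push Not at hall
  obtain ⟨l, hl⟩ := hall
  have hyl : y ∈ f l := by
    simpa using UV.le_of_mem_compression_of_notMem (hf l) hl
  have hxl : x ∉ f l := by
    simpa using UV.disjoint_of_mem_compression_of_notMem (hf l) hl
  refine ⟨fun i => (f i).map (Equiv.swap x y).toEmbedding, fun i => ?_, fun i j hij => ?_⟩
  · beta_reduce
    by_cases hil : i = l
    · subst hil
      have := UV.sup_sdiff_mem_of_mem_compression_of_notMem (hf i) hl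
      rw [Equiv.swap_comm, map_swap_eq_union_sdiff _ hyl hxl]
      exact this
    · have hyi : y ∉ f i := fun h => disjoint_left.1 (hd i l hil) h hyl
      by_cases hxi : x ∈ f i
      · have := UV.sup_sdiff_mem_of_mem_compression (hf i) (by simpa using hxi)
          (by simpa using hyi)
        rw [map_swap_eq_union_sdiff _ hxi hyi]
        exact this
      · rw [map_swap_eq_self _ hxi hyi]
        by_contra hc
        exact hyi (by simpa using UV.le_of_mem_compression_of_notMem (hf i) hc)
  · exact (disjoint_map _).2 (hd i j hij)

lemma compression_mono {u v : Finset α} {F G : Finset (Finset α)} (h : F ⊆ G) :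
    UV.compression u v F ⊆ UV.compression u v G := by
  intro a ha
  rw [UV.mem_compression] at ha ⊢
  rcases ha with ⟨h1, h2⟩ | ⟨h1, b, hb, rfl⟩
  · exact Or.inl ⟨h h1, h h2⟩
  · by_cases hc : UV.compress u v b ∈ G
    · left
      rw [UV.compress_idem]
      exact ⟨hc, hc⟩
    · exact Or.inr ⟨hc, b, h hb, rfl⟩

lemma compress_mem_powersetCard {V A : Finset α} {k : ℕ} {x y : α} (hy : y ∈ V)
    (hA : A ∈ V.powersetCard k) : UV.compress {y} {x} A ∈ V.powersetCard k := by
  rw [mem_powersetCard] at hA ⊢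
  refine ⟨?_, by rw [UV.card_compress (by simp), hA.2]⟩
  unfold UV.compress
  split_ifs
  · exact sdiff_subset.trans (union_subset hA.1 (by simpa using hy))
  · exact hA.1

lemma compression_subset_powersetCard {V : Finset α} {F : Finset (Finset α)} {k : ℕ} {x y : α}
    (hy : y ∈ V) (hF : F ⊆ V.powersetCard k) :
    UV.compression {y} {x} F ⊆ V.powersetCard k := by
  intro A hA
  rw [UV.mem_compression] at hA
  rcases hA with ⟨h1, -⟩ | ⟨-, b, hb, rfl⟩
  · exact hF h1
  · exact compress_mem_powersetCard hy (hF hb)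

lemma sum_compression_lt {u v : Finset α} {F : Finset (Finset α)} (w : Finset α → ℕ)
    (hw : ∀ A ∈ F, UV.compress u v A ∉ F → w (UV.compress u v A) < w A)
    (hne : ∃ A ∈ F, UV.compress u v A ∉ F) :
    ∑ A ∈ UV.compression u v F, w A < ∑ A ∈ F, w A := by
  rw [UV.compression, sum_union UV.compress_disjoint, filter_image,
    sum_image UV.compress_injOn, ← sum_filter_add_sum_filter_not F (UV.compress u v · ∈ F)]
  gcongr ?_ + ?_
  apply sum_lt_sum_of_nonempty
  · obtain ⟨A, hA, h⟩ := hne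
    exact ⟨A, mem_filter.2 ⟨hA, h⟩⟩
  · intro A hA
    rw [mem_filter] at hA
    exact hw A hA.1 hA.2

end Shifting

/-- Replacing an element of a member of `F` by a smaller element of `V` stays inside `F`. -/
def IsShifted {N : ℕ} (V : Finset (Fin N)) (F : Finset (Finset (Fin N))) : Prop :=
  ∀ A ∈ F, ∀ x ∈ A, ∀ y ∈ V, y < x → y ∉ A → (A ∪ {y}) \ {x} ∈ F

lemma exists_isShifted {N m k : ℕ} (V : Finset (Fin N))
    (B : Fin (m + 1) → Finset (Finset (Fin N))) (hB : ∀ i, B i ⊆ V.powersetCard k)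
    (hmono : Monotone B) (hmat : ¬ HasFullMatching B) :
    ∃ B' : Fin (m + 1) → Finset (Finset (Fin N)), (∀ i, B' i ⊆ V.powersetCard k) ∧
      Monotone B' ∧ ¬ HasFullMatching B' ∧ (∀ i, #(B' i) = #(B i)) ∧ IsShifted V (B' 0) := by
  induction hΦ : ∑ A ∈ B 0, ∑ x ∈ A, (x : ℕ) using Nat.strong_induction_on generalizing B with
  | _ Φ ih =>
  by_cases hsh : IsShifted V (B 0)
  · exact ⟨B, hB, hmono, hmat, fun _ => rfl, hsh⟩
  unfold IsShifted at hsh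
  push Not at hsh
  obtain ⟨A, hA, x, hx, y, hy, hyx, hyA, hnot⟩ := hsh
  have key : ∑ A ∈ UV.compression {y} {x} (B 0), ∑ x ∈ A, (x : ℕ) < Φ := by
    rw [← hΦ]
    apply sum_compression_lt
    · intro C hC hCn
      by_cases hc : Disjoint {y} C ∧ {x} ≤ C
      · rw [UV.compress_of_disjoint_of_le hc.1 hc.2]
        have hyC : y ∉ C := by simpa using hc.1
        have hxC : x ∈ C := by simpa using hc.2
        have e : (C ⊔ {y}) \ {x} = insert y (C.erase x) := by
          ext a
          simp only [sup_eq_union, mem_sdiff, mem_union, mem_singleton, mem_insert, mem_erase]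
          constructor
          · tauto
          · rintro (rfl | h)
            · exact ⟨Or.inr rfl, hyx.ne⟩
            · tauto
        rw [e, sum_insert (by simp [hyC]), ← add_sum_erase C _ hxC]
        have : (y : ℕ) < x := hyx
        omega
      · exact absurd hC (by rwa [UV.compress, if_neg hc] at hCn)
    · refine ⟨A, hA, ?_⟩
      rw [UV.compress_of_disjoint_of_le (by simpa using hyA) (by simpa using hx)]
      exact hnot
  obtain ⟨B', h1, h2, h3, h4, h5⟩ := ih _ key (fun i => UV.compression {y} {x} (B i))
    (fun i => compression_subset_powersetCard hy (hB i))
    (fun i j hij => compression_mono (hmono hij)) (fun h => hmat h.of_compression) rfl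
  exact ⟨B', h1, h2, h3, fun i => (h4 i).trans (UV.card_compression _ _ _), h5⟩

section Averaging

variable {α : Type*} [DecidableEq α]

lemma exists_disjoint_blocks {α : Type*} [Fintype α] {q r : ℕ} (h : q * r ≤ Fintype.card α) :
    ∃ b : Fin q → Finset α, (∀ i, #(b i) = r) ∧ ∀ i j, i ≠ j → Disjoint (b i) (b j) := by
  obtain ⟨e⟩ : Nonempty (Fin q × Fin r ↪ α) := by
    apply Function.Embedding.nonempty_of_card_le
    simpa using h
  refine ⟨fun i => univ.map ⟨fun j => e (i, j), fun a b hab => ?_⟩, fun i => by simp,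
    fun i j hij => ?_⟩
  · simpa using hab
  · rw [disjoint_left]
    intro a ha hb
    simp only [mem_map, mem_univ, true_and] at ha hb
    obtain ⟨x, rfl⟩ := ha
    obtain ⟨y, hy⟩ := hb
    exact hij (Prod.ext_iff.1 (e.injective hy)).1.symm

lemma choose_mul_card_perm_map_mem [Fintype α] {r : ℕ} (G : Finset (Finset α))
    (hG : ∀ g ∈ G, #g = r) (b : Finset α) (hb : #b = r) :
    (Fintype.card α).choose r * #{σ : Equiv.Perm α | b.map σ.toEmbedding ∈ G} =
      Fintype.card (Equiv.Perm α) * #G := by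
  have hconst : ∀ b' ∈ (univ : Finset α).powersetCard r,
      #{σ : Equiv.Perm α | b'.map σ.toEmbedding ∈ G} =
        #{σ : Equiv.Perm α | b.map σ.toEmbedding ∈ G} := by
    intro b' hb'
    rw [mem_powersetCard] at hb'
    obtain ⟨τ, hτ⟩ := Equiv.Perm.exists_map_finset_eq b b' (hb.trans hb'.2.symm)
    apply card_equiv (Equiv.mulRight τ)
    intro σ
    simp only [mem_filter, mem_univ, true_and, Equiv.coe_mulRight, ← hτ, map_map]
    rfl
  have hfib : ∀ σ : Equiv.Perm α,
      #{b' ∈ (univ : Finset α).powersetCard r | b'.map σ.toEmbedding ∈ G} = #G := by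
    intro σ
    refine card_bij' (fun b' _ => b'.map σ.toEmbedding) (fun g _ => g.map σ.symm.toEmbedding)
      (fun b' hb' => (mem_filter.1 hb').2) (fun g hg => ?_) (fun b' _ => ?_) (fun g _ => ?_)
    · simp [mem_powersetCard, map_map, hG g hg, hg]
    · simp [map_map]
    · simp [map_map]
  calc _ = ∑ b' ∈ (univ : Finset α).powersetCard r,
        #{σ : Equiv.Perm α | b'.map σ.toEmbedding ∈ G} := by
        rw [sum_congr rfl hconst, sum_const, card_powersetCard, card_univ, smul_eq_mul]
    _ = ∑ σ : Equiv.Perm α,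
        #{b' ∈ (univ : Finset α).powersetCard r | b'.map σ.toEmbedding ∈ G} :=
        sum_card_bipartiteAbove_eq_sum_card_bipartiteBelow _
    _ = _ := by simp [hfib]

lemma mul_card_le_of_not_hasFullMatching_univ [Fintype α] {q r s : ℕ} (G : Finset (Finset α))
    (hG : ∀ g ∈ G, #g = r) (hqr : q * r ≤ Fintype.card α)
    (hmat : ¬ HasFullMatching fun _ : Fin (s + 1) => G) :
    q * #G ≤ s * (Fintype.card α).choose r := by
  obtain ⟨b, hb, hd⟩ := exists_disjoint_blocks hqr
  have hle : ∀ σ : Equiv.Perm α, #{i : Fin q | (b i).map σ.toEmbedding ∈ G} ≤ s := by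
    intro σ
    by_contra! hc
    obtain ⟨t, hts, ht⟩ := exists_subset_card_eq hc
    refine hmat ⟨fun j => (b (t.orderEmbOfFin ht j)).map σ.toEmbedding, fun j => ?_,
      fun i j hij => ?_⟩
    · exact (mem_filter.1 (hts (t.orderEmbOfFin_mem ht j))).2
    · exact (disjoint_map _).2 (hd _ _ fun h => hij ((t.orderEmbOfFin ht).injective h))
  have hsum : ∑ i : Fin q, #{σ : Equiv.Perm α | (b i).map σ.toEmbedding ∈ G} ≤
      Fintype.card (Equiv.Perm α) * s := by
    calc _ = ∑ σ : Equiv.Perm α, #{i : Fin q | (b i).map σ.toEmbedding ∈ G} :=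
        sum_card_bipartiteAbove_eq_sum_card_bipartiteBelow _
      _ ≤ ∑ _σ : Equiv.Perm α, s := sum_le_sum fun σ _ => hle σ
      _ = _ := by simp
  apply Nat.le_of_mul_le_mul_left _ (Fintype.card_pos (α := Equiv.Perm α))
  calc _ = ∑ _i : Fin q, Fintype.card (Equiv.Perm α) * #G := by simp; ring
    _ = (Fintype.card α).choose r *
        ∑ i : Fin q, #{σ : Equiv.Perm α | (b i).map σ.toEmbedding ∈ G} := by
        rw [mul_sum]
        exact sum_congr rfl fun i _ => (choose_mul_card_perm_map_mem G hG (b i) (hb i)).symm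
    _ ≤ (Fintype.card α).choose r * (Fintype.card (Equiv.Perm α) * s) := by gcongr
    _ = _ := by ring

lemma mul_card_le_of_not_hasFullMatching {q r s : ℕ} (V : Finset α) (G : Finset (Finset α))
    (hG : G ⊆ V.powersetCard r) (hqr : q * r ≤ #V)
    (hmat : ¬ HasFullMatching fun _ : Fin (s + 1) => G) :
    q * #G ≤ s * (#V).choose r := by
  have hback : ∀ g ∈ G, (g.subtype (· ∈ V)).map (Function.Embedding.subtype _) = g :=
    fun g hg => subtype_map_of_mem fun x hx => (mem_powersetCard.1 (hG hg)).1 hx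
  have hcard : #(G.image fun g => g.subtype (· ∈ V)) = #G := by
    apply card_image_of_injOn
    intro g hg g' hg' h
    rw [← hback g hg, ← hback g' hg']
    exact congrArg _ h
  rw [← hcard, ← Fintype.card_coe V]
  apply mul_card_le_of_not_hasFullMatching_univ
  · intro g hg
    obtain ⟨g', hg', rfl⟩ := mem_image.1 hg
    rw [← card_map (Function.Embedding.subtype _), hback g' hg']
    exact (mem_powersetCard.1 (hG hg')).2
  · rwa [Fintype.card_coe]
  · rintro ⟨f, hf, hd⟩
    refine hmat ⟨fun i => (f i).map (Function.Embedding.subtype _), fun i => ?_, fun i j hij => ?_⟩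
    · obtain ⟨g, hg, h⟩ := mem_image.1 (hf i)
      beta_reduce
      rw [← h, hback g hg]
      exact hg
    · exact (disjoint_map _).2 (hd i j hij)

end Averaging

section Degrees

variable {α : Type*} [DecidableEq α]

lemma card_filter_superset_le {V D : Finset α} {F : Finset (Finset α)} {k : ℕ}
    (hF : F ⊆ V.powersetCard k) (hD : D ⊆ V) :
    #{A ∈ F | D ⊆ A} ≤ (#V - #D).choose (k - #D) := by
  rw [← card_sdiff_of_subset hD, ← card_powersetCard]
  apply card_le_card_of_injOn (· \ D)
  · intro A hA
    rw [mem_coe, mem_filter] at hA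
    have := mem_powersetCard.1 (hF hA.1)
    rw [mem_coe, mem_powersetCard, card_sdiff_of_subset hA.2, this.2]
    exact ⟨sdiff_subset_sdiff this.1 le_rfl, rfl⟩
  · intro A hA A' hA' h
    rw [mem_coe, mem_filter] at hA hA'
    rw [← sdiff_union_of_subset hA.2, ← sdiff_union_of_subset hA'.2]
    exact congrArg (· ∪ D) h

lemma card_filter_mem_le {V : Finset α} {F : Finset (Finset α)} {k : ℕ} {v : α}
    (hF : F ⊆ V.powersetCard k) (hv : v ∈ V) :
    #{A ∈ F | v ∈ A} ≤ (#V - 1).choose (k - 1) := by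
  simpa using card_filter_superset_le hF (singleton_subset_iff.2 hv)

/-- If every member of `F` containing `v` meets `U`, then `v` has degree at most `|U|` times the
largest possible codegree. -/
lemma card_filter_mem_le_of_meets {V U : Finset α} {F : Finset (Finset α)} {k : ℕ} {v : α}
    (hF : F ⊆ V.powersetCard k) (hv : v ∈ V) (hU : U ⊆ V) (hvU : v ∉ U)
    (h : ∀ A ∈ F, v ∈ A → ¬ Disjoint A U) :
    #{A ∈ F | v ∈ A} ≤ #U * (#V - 2).choose (k - 2) := by
  calc _ ≤ #(U.biUnion fun u => {A ∈ F | {v, u} ⊆ A}) := by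
        apply card_le_card
        intro A hA
        rw [mem_filter] at hA
        obtain ⟨u, huA, huU⟩ := not_disjoint_iff.1 (h A hA.1 hA.2)
        rw [mem_biUnion]
        refine ⟨u, huU, mem_filter.2 ⟨hA.1, ?_⟩⟩
        rw [insert_subset_iff, singleton_subset_iff]
        exact ⟨hA.2, huA⟩
    _ ≤ _ := by
        apply card_biUnion_le_card_mul
        intro u hu
        have hne : v ≠ u := fun h => hvU (h ▸ hu)
        have := card_filter_superset_le hF (D := {v, u}) (by
          rw [insert_subset_iff, singleton_subset_iff]
          exact ⟨hv, hU hu⟩)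
        rwa [card_pair hne] at this

lemma card_filter_not_disjoint_le (F : Finset (Finset α)) (D : Finset α) :
    #{A ∈ F | ¬ Disjoint A D} ≤ ∑ v ∈ D, #{A ∈ F | v ∈ A} := by
  refine le_trans (card_le_card ?_) card_biUnion_le
  intro A hA
  rw [mem_filter] at hA
  obtain ⟨u, huA, huD⟩ := not_disjoint_iff.1 hA.2
  exact mem_biUnion.2 ⟨u, huD, mem_filter.2 ⟨hA.1, huA⟩⟩

end Degrees

section Counting

/-- The number of `k`-subsets of an `n`-set that meet a fixed `s`-subset. -/
def coverCount (n k s : ℕ) : ℕ := ∑ i ∈ range s, (n - 1 - i).choose (k - 1)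

lemma coverCount_succ (n k s : ℕ) :
    coverCount n k (s + 1) = (n - 1).choose (k - 1) + coverCount (n - 1) k s := by
  rw [coverCount, sum_range_succ', add_comm, coverCount]
  congr 1
  refine sum_congr rfl fun i _ => ?_
  congr 1
  omega

lemma coverCount_mono {m n : ℕ} (h : m ≤ n) (k s : ℕ) : coverCount m k s ≤ coverCount n k s :=
  sum_le_sum fun i _ => Nat.choose_le_choose _ (by omega)

lemma coverCount_add_choose {n k s : ℕ} (hk : 0 < k) (hs : s ≤ n) :
    coverCount n k s + (n - s).choose k = n.choose k := by
  induction s with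
  | zero => simp [coverCount]
  | succ s ih =>
    obtain ⟨j, rfl⟩ : ∃ j, k = j + 1 := ⟨k - 1, by omega⟩
    rw [← ih (by omega), coverCount, sum_range_succ, ← coverCount, add_assoc]
    have : n - s = (n - (s + 1)) + 1 := by omega
    rw [this, Nat.choose_succ_succ, show n - 1 - s = n - (s + 1) by omega]
    rfl

lemma add_mul_choose_sub_le {n k p s : ℕ} (hn : n ≤ p * k) (hs : s ≤ n) :
    (p + s) * (n - s).choose k ≤ p * n.choose k := by
  induction s with
  | zero => simp
  | succ s ih =>
    refine le_trans ?_ (ih (by omega))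
    obtain ⟨m, hm⟩ : ∃ m, n - s = m + 1 := ⟨n - s - 1, by omega⟩
    rw [hm, show n - (s + 1) = m by omega]
    apply Nat.le_of_mul_le_mul_right _ (Nat.succ_pos m)
    suffices h : (p + (s + 1)) * (m + 1 - k) ≤ (p + s) * (m + 1) by
      calc _ = (m + 1).choose k * ((p + (s + 1)) * (m + 1 - k)) := by
            rw [mul_assoc, Nat.choose_mul_succ_eq, mul_left_comm]
        _ ≤ (m + 1).choose k * ((p + s) * (m + 1)) := Nat.mul_le_mul_left _ h
        _ = _ := by rw [Nat.succ_eq_add_one]; ring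
    rcases le_total (m + 1) k with h | h
    · simp [Nat.sub_eq_zero_of_le h]
    · obtain ⟨d, hd⟩ := Nat.exists_eq_add_of_le h
      rw [hd, Nat.add_sub_cancel_left]
      have h1 : d ≤ p * k := by omega
      nlinarith [Nat.zero_le (s * k)]

lemma mul_choose_le_add_mul_coverCount {n k p s : ℕ} (hk : 0 < k) (hn : n ≤ p * k)
    (hs : s ≤ n) : s * n.choose k ≤ (p + s) * coverCount n k s := by
  have h1 := coverCount_add_choose hk hs
  have h2 := add_mul_choose_sub_le hn hs
  nlinarith

lemma four_mul_mul_choose_sub_two_le {n k s : ℕ} (hk : 2 ≤ k) (hs : 0 < s)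
    (hn : 4 * k ^ 2 * s ≤ n) :
    4 * (k * s * (n - 2).choose (k - 2)) ≤ (n - 1).choose (k - 1) := by
  have h4 : 16 ≤ 4 * k ^ 2 * s := by nlinarith [Nat.mul_le_mul hk hk]
  obtain ⟨m, rfl⟩ : ∃ m, n = m + 2 := ⟨n - 2, by omega⟩
  obtain ⟨j, rfl⟩ : ∃ j, k = j + 2 := ⟨k - 2, by omega⟩
  have h := Nat.add_one_mul_choose_eq m j
  simp only [Nat.add_sub_cancel, show m + 2 - 1 = m + 1 by omega,
    show j + 2 - 1 = j + 1 by omega]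
  apply Nat.le_of_mul_le_mul_left _ (Nat.succ_pos m)
  calc (m + 1) * (4 * ((j + 2) * s * m.choose j))
      = 4 * (j + 2) * s * ((m + 1) * m.choose j) := by ring
    _ = (4 * (j + 2) * s * (j + 1)) * (m + 1).choose (j + 1) := by rw [h]; ring
    _ ≤ (m + 1) * (m + 1).choose (j + 1) := by
      gcongr
      nlinarith

end Counting

lemma exists_initial_segment {β : Type*} [LinearOrder β] (V : Finset β) {s : ℕ} (hs : s ≤ #V) :
    ∃ S ⊆ V, #S = s ∧ ∀ x ∈ V, x ∉ S → ∀ y ∈ S, y < x := by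
  induction s with
  | zero => exact ⟨∅, by simp⟩
  | succ s ih =>
    obtain ⟨S, hSV, hS, hlt⟩ := ih (by omega)
    have hne : (V \ S).Nonempty := by
      rw [← card_pos, card_sdiff_of_subset hSV]
      omega
    have hmem := mem_sdiff.1 (min'_mem _ hne)
    refine ⟨insert ((V \ S).min' hne) S, insert_subset hmem.1 hSV, ?_, ?_⟩
    · rw [card_insert_of_notMem hmem.2, hS]
    · intro x hx hxS y hy
      rw [mem_insert, not_or] at hxS
      rcases mem_insert.1 hy with rfl | hy
      · exact lt_of_le_of_ne (min'_le _ _ (mem_sdiff.2 ⟨hx, hxS.2⟩)) (Ne.symm hxS.1)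
      · exact hlt x hx hxS.2 y hy

section Main

variable {N : ℕ} {V S : Finset (Fin N)} {F : Finset (Finset (Fin N))} {k s : ℕ}

lemma IsShifted.not_hasFullMatching_link (hF : IsShifted V F) (hSV : S ⊆ V) (hS : #S = s)
    {x : Fin N} (hxS : x ∉ S) (hlt : ∀ y ∈ S, y < x)
    (hmat : ¬ HasFullMatching fun _ : Fin (s + 1) => F) :
    ¬ HasFullMatching fun _ : Fin (s + 1) =>
      ({A ∈ F | x ∈ A ∧ Disjoint A S} : Finset (Finset (Fin N))).image (·.erase x) := by
  rintro ⟨g, hg, hd⟩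
  have hcard : #(insert x S) = s + 1 := by rw [card_insert_of_notMem hxS, hS]
  set y := (insert x S).orderEmbOfFin hcard
  have hy : ∀ i, y i ∈ insert x S := fun i => orderEmbOfFin_mem _ hcard i
  have hgx : ∀ i, x ∉ g i ∧ Disjoint (g i) S ∧ insert (y i) (g i) ∈ F := by
    intro i
    obtain ⟨A, hA, hgA⟩ := mem_image.1 (hg i)
    rw [← hgA]
    obtain ⟨hAF, hxA, hAS⟩ := mem_filter.1 hA
    refine ⟨notMem_erase _ _, hAS.mono_left (erase_subset _ _), ?_⟩
    rcases mem_insert.1 (hy i) with h | h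
    · rw [h, insert_erase hxA]
      exact hAF
    · have hyA : y i ∉ A := fun h' => disjoint_left.1 hAS h' h
      have := hF A hAF x hxA (y i) (hSV h) (hlt _ h) hyA
      convert this using 1
      ext a
      have hne : y i ≠ x := (hlt _ h).ne
      simp only [mem_insert, mem_erase, mem_sdiff, mem_union, mem_singleton]
      constructor
      · rintro (rfl | h)
        · exact ⟨Or.inr rfl, hne⟩
        · exact ⟨Or.inl h.2, h.1⟩
      · tauto
  have hyg : ∀ i j, y i ∉ g j := by
    intro i j h
    rcases mem_insert.1 (hy i) with h' | h'
    · exact (hgx j).1 (h' ▸ h)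
    · exact disjoint_left.1 (hgx j).2.1 h h'
  refine hmat ⟨fun i => insert (y i) (g i), fun i => (hgx i).2.2, fun i j hij => ?_⟩
  simp only [disjoint_insert_left, disjoint_insert_right, mem_insert, not_or]
  exact ⟨⟨fun h => hij (y.injective h).symm, hyg j i⟩, hyg i j, hd i j hij⟩

lemma IsShifted.degree_le (hF : IsShifted V F) (hFV : F ⊆ V.powersetCard k) (hk : 2 ≤ k)
    (hs : 0 < s) (hn : 4 * k ^ 2 * s ≤ #V) (hSV : S ⊆ V) (hS : #S = s)
    {x : Fin N} (hxV : x ∈ V) (hxS : x ∉ S) (hlt : ∀ y ∈ S, y < x)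
    (hmat : ¬ HasFullMatching fun _ : Fin (s + 1) => F) :
    4 * ((k - 1) * #{A ∈ F | x ∈ A}) ≤
      4 * (k * s * (#V - 2).choose (k - 2)) + (#V - 1).choose (k - 1) := by
  set G := ({A ∈ F | x ∈ A ∧ Disjoint A S} : Finset (Finset (Fin N))).image (·.erase x)
    with hGdef
  have hGcard : #G = #{A ∈ F | x ∈ A ∧ Disjoint A S} := by
    apply card_image_of_injOn
    intro A hA A' hA' h
    rw [mem_coe, mem_filter] at hA hA'
    rw [← insert_erase hA.2.1, ← insert_erase hA'.2.1]
    exact congrArg _ h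
  have hxScard : #(insert x S) = s + 1 := by rw [card_insert_of_notMem hxS, hS]
  have hVcard : #(V \ insert x S) = #V - (s + 1) := by
    rw [card_sdiff_of_subset (insert_subset hxV hSV), hxScard]
  have hGV : G ⊆ (V \ insert x S).powersetCard (k - 1) := by
    intro g hg
    obtain ⟨A, hA, rfl⟩ := mem_image.1 hg
    obtain ⟨hAF, hxA, hAS⟩ := mem_filter.1 hA
    have hA' := mem_powersetCard.1 (hFV hAF)
    rw [mem_powersetCard, card_erase_of_mem hxA, hA'.2]
    refine ⟨fun a ha => ?_, rfl⟩
    rw [mem_erase] at ha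
    rw [mem_sdiff, mem_insert, not_or]
    exact ⟨hA'.1 ha.2, ha.1, disjoint_left.1 hAS ha.2⟩
  have hG := mul_card_le_of_not_hasFullMatching (q := 4 * (k - 1) * s) _ G hGV (by
    rw [hVcard]
    obtain ⟨j, rfl⟩ : ∃ j, k = j + 1 := ⟨k - 1, by omega⟩
    apply Nat.le_sub_of_add_le
    rw [Nat.add_sub_cancel]
    nlinarith) (hF.not_hasFullMatching_link hSV hS hxS hlt hmat)
  have hG' : 4 * ((k - 1) * #G) ≤ (#V - 1).choose (k - 1) := by
    apply Nat.le_of_mul_le_mul_left _ hs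
    calc _ = 4 * (k - 1) * s * #G := by ring
      _ ≤ _ := hG
      _ ≤ _ := by
        gcongr
        omega
  have hmeet : #{A ∈ F | x ∈ A ∧ ¬ Disjoint A S} ≤ s * (#V - 2).choose (k - 2) := by
    have := card_filter_mem_le_of_meets (F := {A ∈ F | ¬ Disjoint A S}) (v := x) (U := S)
      ((filter_subset _ _).trans hFV) hxV hSV hxS (fun A hA _ => (mem_filter.1 hA).2)
    rw [hS, filter_filter] at this
    simpa only [and_comm] using this
  have hsplit : #{A ∈ F | x ∈ A} =
      #{A ∈ F | x ∈ A ∧ Disjoint A S} + #{A ∈ F | x ∈ A ∧ ¬ Disjoint A S} := by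
    rw [← card_filter_add_card_filter_not (s := {A ∈ F | x ∈ A}) (Disjoint · S), filter_filter,
      filter_filter]
  rw [hsplit, ← hGcard]
  have : (k - 1) * #{A ∈ F | x ∈ A ∧ ¬ Disjoint A S} ≤ k * s * (#V - 2).choose (k - 2) := by
    rw [mul_assoc]
    exact Nat.mul_le_mul (Nat.sub_le _ _) hmeet
  rw [mul_add]
  omega

/-- If no vertex has large degree, a shifted family without `s + 1` disjoint members has a member
whose vertices have small total degree. -/
lemma IsShifted.exists_sum_degree_le (hF : IsShifted V F) (hFV : F ⊆ V.powersetCard k)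
    (hk : 2 ≤ k) (hs : 0 < s) (hn : 4 * k ^ 2 * s ≤ #V)
    (hmat : ¬ HasFullMatching fun _ : Fin (s + 1) => F) (hne : F.Nonempty)
    (hdeg : ∀ v ∈ V, #{A ∈ F | v ∈ A} ≤ k * s * (#V - 2).choose (k - 2)) :
    ∃ e ∈ F, 4 * ∑ v ∈ e, #{A ∈ F | v ∈ A} ≤ 3 * (#V - 1).choose (k - 1) := by
  have hc := four_mul_mul_choose_sub_two_le hk hs hn
  have hsV : s ≤ #V := (Nat.le_mul_of_pos_left s (by positivity)).trans hn
  obtain ⟨S, hSV, hS, hlt⟩ := exists_initial_segment V hsV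
  obtain ⟨e, he, v, hv, hrest⟩ : ∃ e ∈ F, ∃ v ∈ e, ∀ x ∈ e.erase v,
      4 * ((k - 1) * #{A ∈ F | x ∈ A}) ≤ 2 * (#V - 1).choose (k - 1) := by
    by_cases hex : ∃ e ∈ F, ∃ v ∈ e, Disjoint (e.erase v) S
    · obtain ⟨e, he, v, hv, hd⟩ := hex
      refine ⟨e, he, v, hv, fun x hx => ?_⟩
      have hxV := (mem_powersetCard.1 (hFV he)).1 (mem_of_mem_erase hx)
      have hxS := disjoint_left.1 hd hx
      have := hF.degree_le hFV hk hs hn hSV hS hxV hxS (hlt x hxV hxS) hmat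
      omega
    · push Not at hex
      obtain ⟨e, he⟩ := hne
      have heV := mem_powersetCard.1 (hFV he)
      obtain ⟨v, hv⟩ : e.Nonempty := by
        rw [← card_pos]
        omega
      refine ⟨e, he, v, hv, fun x hx => ?_⟩
      have hxV := heV.1 (mem_of_mem_erase hx)
      have h1 := card_filter_mem_le_of_meets (v := x) (U := S.erase x) hFV hxV
        ((erase_subset _ _).trans hSV) (notMem_erase _ _) (fun A hA hxA => by
          have := hex A hA x hxA
          rw [not_disjoint_iff] at this ⊢
          obtain ⟨a, ha, haS⟩ := this
          rw [mem_erase] at ha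
          exact ⟨a, ha.2, mem_erase.2 ⟨ha.1, haS⟩⟩)
      have h2 : #(S.erase x) ≤ s := hS ▸ card_le_card (erase_subset _ _)
      have h3 : (k - 1) * #{A ∈ F | x ∈ A} ≤ k * s * (#V - 2).choose (k - 2) := by
        rw [mul_assoc]
        exact Nat.mul_le_mul (Nat.sub_le _ _) (h1.trans (Nat.mul_le_mul_right _ h2))
      omega
  refine ⟨e, he, ?_⟩
  have heV := mem_powersetCard.1 (hFV he)
  have hv' := hdeg v (heV.1 hv)
  have hsum : 4 * ∑ x ∈ e.erase v, #{A ∈ F | x ∈ A} ≤ 2 * (#V - 1).choose (k - 1) := by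
    apply Nat.le_of_mul_le_mul_left _ (show 0 < k - 1 by omega)
    calc _ = ∑ x ∈ e.erase v, 4 * ((k - 1) * #{A ∈ F | x ∈ A}) := by
          rw [← mul_sum, ← mul_sum]
          ring
      _ ≤ ∑ _x ∈ e.erase v, 2 * (#V - 1).choose (k - 1) := sum_le_sum hrest
      _ = _ := by rw [sum_const, card_erase_of_mem hv, heV.2, smul_eq_mul]
  rw [← add_sum_erase e _ hv]
  omega

/-- The upper bound for nested overlapping sequences of `s + 1` families of `k`-sets. -/
def NestedBound (N k s : ℕ) : Prop :=
  ∀ (p : ℕ) (V : Finset (Fin N)) (B : Fin (s + 1) → Finset (Finset (Fin N))),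
    4 * k ^ 2 * s ≤ #V → #V ≤ p * k → (∀ i, B i ⊆ V.powersetCard k) → Monotone B →
    ¬ HasFullMatching B →
    p * #(B 0) + ∑ i : Fin s, #(B i.succ) ≤ (p + s) * coverCount (#V) k s

lemma NestedBound.of_delete (ih : NestedBound N k s) {p : ℕ} {D : Finset (Fin N)}
    {B : Fin (s + 1 + 1) → Finset (Finset (Fin N))} (hk : 0 < k)
    (hn : 4 * k ^ 2 * (s + 1) ≤ #V) (hp : #V ≤ p * k) (hB : ∀ i, B i ⊆ V.powersetCard k)
    (hmono : Monotone B) (hDV : D ⊆ V) (hD : 0 < #D) (hDk : #D ≤ k)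
    (hmat : ¬ HasFullMatching fun i : Fin (s + 1) => {A ∈ B i.succ | Disjoint A D})
    (hmeet : p * #{A ∈ B 0 | ¬ Disjoint A D} + ∑ i : Fin (s + 1),
      #{A ∈ B i.succ | ¬ Disjoint A D} ≤ (p + (s + 1)) * (#V - 1).choose (k - 1)) :
    p * #(B 0) + ∑ i : Fin (s + 1), #(B i.succ) ≤ (p + (s + 1)) * coverCount (#V) k (s + 1) := by
  have hVD : #(V \ D) = #V - #D := card_sdiff_of_subset hDV
  have h1 := ih (p + 1) (V \ D) (fun i => {A ∈ B i.succ | Disjoint A D})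
    (by rw [hVD]; apply Nat.le_sub_of_add_le; nlinarith)
    (by rw [hVD]; have : (p + 1) * k = p * k + k := by ring
        omega)
    (fun i A hA => by
      rw [mem_filter] at hA
      have := mem_powersetCard.1 (hB _ hA.1)
      exact mem_powersetCard.2 ⟨subset_sdiff.2 ⟨this.1, hA.2⟩, this.2⟩)
    (fun i j hij => filter_subset_filter _ (hmono (Fin.succ_le_succ_iff.2 hij))) hmat
  have h2 : coverCount #(V \ D) k s ≤ coverCount (#V - 1) k s :=
    coverCount_mono (by omega) k s
  have h3 : #{A ∈ B 0 | Disjoint A D} ≤ #{A ∈ B (Fin.succ 0) | Disjoint A D} :=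
    card_le_card (filter_subset_filter _ (hmono (Fin.zero_le _)))
  have hsplit : ∀ i, #(B i) = #{A ∈ B i | Disjoint A D} + #{A ∈ B i | ¬ Disjoint A D} :=
    fun i => (card_filter_add_card_filter_not _).symm
  have h4 : ∑ i : Fin (s + 1), #(B i.succ) = ∑ i : Fin (s + 1), #{A ∈ B i.succ | Disjoint A D} +
      ∑ i : Fin (s + 1), #{A ∈ B i.succ | ¬ Disjoint A D} := by
    rw [← sum_add_distrib]
    exact sum_congr rfl fun i _ => hsplit _
  have h5 := Fin.sum_univ_succ fun i : Fin (s + 1) => #{A ∈ B i.succ | Disjoint A D}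
  rw [coverCount_succ, h4, hsplit 0, h5]
  have h6 := Nat.mul_le_mul_left (p + 1 + s) h2
  have h7 := Nat.mul_le_mul_left p h3
  nlinarith

lemma exists_cover_of_hasFullMatching {m : ℕ} {B : Fin m → Finset (Finset (Fin N))}
    (hB : ∀ i, B i ⊆ V.powersetCard k) (h : HasFullMatching B) :
    ∃ f : Fin m → Finset (Fin N), (∀ i, f i ∈ B i) ∧ (∀ i j, i ≠ j → Disjoint (f i) (f j)) ∧
      univ.biUnion f ⊆ V ∧ #(univ.biUnion f) ≤ k * m := by
  obtain ⟨f, hf, hd⟩ := h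
  refine ⟨f, hf, hd, biUnion_subset.2 fun i _ => (mem_powersetCard.1 (hB i (hf i))).1, ?_⟩
  rw [mul_comm]
  simpa using card_biUnion_le_card_mul univ f k fun i _ => (mem_powersetCard.1 (hB i (hf i))).2.le

lemma not_hasFullMatching_succ_of_mem {α : Type*} [DecidableEq α] {m : ℕ}
    {B : Fin (m + 1) → Finset (Finset α)} {e : Finset α}
    (he : e ∈ B 0) (hmat : ¬ HasFullMatching B) :
    ¬ HasFullMatching fun i : Fin m => {A ∈ B i.succ | Disjoint A e} := by
  rintro ⟨f, hf, hd⟩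
  refine hmat ⟨Fin.cons e f, fun i => ?_, fun i j hij => ?_⟩
  · cases i using Fin.cases with
    | zero => exact he
    | succ i => exact (mem_filter.1 (hf i)).1
  · cases i using Fin.cases with
    | zero =>
      cases j using Fin.cases with
      | zero => exact absurd rfl hij
      | succ j => exact (mem_filter.1 (hf j)).2.symm
    | succ i =>
      cases j using Fin.cases with
      | zero => exact (mem_filter.1 (hf i)).2
      | succ j => exact hd i j fun h => hij (congrArg _ h)

lemma nestedBound_succ_of_isShifted (hk : 0 < k) (ih : NestedBound N k s) {p : ℕ}
    {B : Fin (s + 1 + 1) → Finset (Finset (Fin N))}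
    (hn : 4 * k ^ 2 * (s + 1) ≤ #V) (hp : #V ≤ p * k) (hB : ∀ i, B i ⊆ V.powersetCard k)
    (hmono : Monotone B) (hmat : ¬ HasFullMatching B) (hsh : IsShifted V (B 0)) :
    p * #(B 0) + ∑ i : Fin (s + 1), #(B i.succ) ≤ (p + (s + 1)) * coverCount (#V) k (s + 1) := by
  have hsV : s + 1 ≤ #V := (Nat.le_mul_of_pos_left _ (by positivity)).trans hn
  have hu : ∀ i, ∀ v ∈ V, #{A ∈ B i | v ∈ A} ≤ (#V - 1).choose (k - 1) :=
    fun i v hv => card_filter_mem_le (hB i) hv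
  rcases (B 0).eq_empty_or_nonempty with h0 | hne
  · rw [h0, card_empty, mul_zero, zero_add]
    refine le_trans ?_ (mul_choose_le_add_mul_coverCount hk hp hsV)
    calc _ ≤ ∑ _i : Fin (s + 1), (#V).choose k :=
          sum_le_sum fun i _ => (card_le_card (hB i.succ)).trans (card_powersetCard _ _).le
      _ = _ := by simp
  by_cases hA : ∃ v ∈ V, ¬ HasFullMatching fun i : Fin (s + 1) => {A ∈ B i.succ | Disjoint A {v}}
  · obtain ⟨v, hv, hvm⟩ := hA
    refine ih.of_delete hk hn hp hB hmono (singleton_subset_iff.2 hv) (by simp)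
      (by rwa [card_singleton]) hvm ?_
    simp only [disjoint_singleton_right, not_not]
    calc _ ≤ p * (#V - 1).choose (k - 1) + ∑ _i : Fin (s + 1), (#V - 1).choose (k - 1) := by
          gcongr with i
          · exact hu 0 v hv
          · exact hu _ v hv
      _ = _ := by simp; ring
  push Not at hA
  obtain ⟨e, he, hdege⟩ : ∃ e ∈ B 0,
      p * #{A ∈ B 0 | ¬ Disjoint A e} + (s + 1) * (k * (#V - 1).choose (k - 1)) ≤
        (p + (s + 1)) * (#V - 1).choose (k - 1) := by
    rcases Nat.lt_or_ge k 2 with hk2 | hk2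
    · obtain rfl : k = 1 := by omega
      obtain ⟨e, he⟩ := hne
      have heV := mem_powersetCard.1 (hB 0 he)
      obtain ⟨v, rfl⟩ := card_eq_one.1 heV.2
      refine ⟨{v}, he, ?_⟩
      simp only [disjoint_singleton_right, not_not]
      have := Nat.mul_le_mul_left p (hu 0 v (by simpa using heV.1))
      rw [one_mul, add_mul p]
      exact Nat.add_le_add_right this _
    · have hmat0 : ¬ HasFullMatching fun _ : Fin (s + 1 + 1) => B 0 :=
        fun ⟨f, hf, hd⟩ => hmat ⟨f, fun i => hmono (Fin.zero_le i) (hf i), hd⟩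
      obtain ⟨e, he, h⟩ := hsh.exists_sum_degree_le (hB 0) hk2 (Nat.succ_pos s) hn hmat0 hne
        (fun v hv => by
          obtain ⟨f, hf, hd, hfV, hfc⟩ := exists_cover_of_hasFullMatching
            (fun i => (filter_subset _ _).trans (hB i.succ)) (hA v hv)
          refine (card_filter_mem_le_of_meets (hB 0) hv hfV ?_ ?_).trans
            (Nat.mul_le_mul_right _ hfc)
          · intro h
            obtain ⟨i, -, hi⟩ := mem_biUnion.1 h
            exact disjoint_left.1 (mem_filter.1 (hf i)).2 hi (mem_singleton_self v)
          · intro A hA0 _ hAd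
            rw [disjoint_biUnion_right] at hAd
            exact not_hasFullMatching_succ_of_mem hA0 hmat
              ⟨f, fun i => mem_filter.2 ⟨(mem_filter.1 (hf i)).1, (hAd i (mem_univ i)).symm⟩, hd⟩)
      refine ⟨e, he, ?_⟩
      have h1 := card_filter_not_disjoint_le (B 0) e
      have h2 : 4 * (k * (s + 1)) ≤ p := by
        apply Nat.le_of_mul_le_mul_right _ hk
        nlinarith
      have h3 := Nat.mul_le_mul_left p (h.trans' (Nat.mul_le_mul_left 4 h1))
      have h4 := Nat.mul_le_mul_right ((#V - 1).choose (k - 1)) h2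
      nlinarith
  have heV := mem_powersetCard.1 (hB 0 he)
  refine ih.of_delete hk hn hp hB hmono heV.1 (heV.2 ▸ hk) heV.2.le
    (not_hasFullMatching_succ_of_mem he hmat) (le_trans ?_ hdege)
  gcongr
  calc _ ≤ ∑ _i : Fin (s + 1), k * (#V - 1).choose (k - 1) := by
        gcongr with i
        refine (card_filter_not_disjoint_le _ _).trans ?_
        calc _ ≤ ∑ _v ∈ e, (#V - 1).choose (k - 1) :=
              sum_le_sum fun v hv => hu _ v (heV.1 hv)
          _ = _ := by rw [sum_const, heV.2, smul_eq_mul]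
    _ = _ := by simp

lemma nestedBound (N : ℕ) (hk : 0 < k) (s : ℕ) : NestedBound N k s := by
  induction s with
  | zero =>
    intro p V B _ _ _ _ hmat
    have : B 0 = ∅ := by
      rw [eq_empty_iff_forall_notMem]
      intro A hA
      exact hmat ⟨fun _ => A, fun i => by rwa [Fin.fin_one_eq_zero i],
        fun i j hij => absurd (by omega) hij⟩
    simp [this]
  | succ s ih =>
    intro p V B hn hp hB hmono hmat
    obtain ⟨B', hB', hmono', hmat', hcard, hsh⟩ := exists_isShifted V B hB hmono hmat
    simp only [← hcard]
    exact nestedBound_succ_of_isShifted hk ih hn hp hB' hmono' hmat' hsh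

end Main

/-- The `k`-subsets meeting a fixed `s`-set attain the bound. -/
lemma card_filter_not_disjoint_powersetCard {α : Type*} [DecidableEq α] [Fintype α]
    (S : Finset α) (k : ℕ) :
    #{A ∈ (univ : Finset α).powersetCard k | ¬ Disjoint A S} =
      (Fintype.card α).choose k - (Fintype.card α - #S).choose k := by
  have h : {A ∈ (univ : Finset α).powersetCard k | Disjoint A S} = Sᶜ.powersetCard k := by
    ext A
    simp [mem_powersetCard, subset_compl_iff_disjoint_right, and_comm]
  have := card_filter_add_card_filter_not (s := (univ : Finset α).powersetCard k) (Disjoint · S)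
  rw [h, card_powersetCard, card_powersetCard, card_compl, card_univ] at this
  omega

lemma not_hasFullMatching_of_meets {α : Type*} {S : Finset α} {s : ℕ} (hS : #S = s)
    {F : Finset (Finset α)} (hF : ∀ A ∈ F, ¬ Disjoint A S) :
    ¬ HasFullMatching fun _ : Fin (s + 1) => F := by
  rintro ⟨f, hf, hd⟩
  have h : ∀ i, ∃ a ∈ f i, a ∈ S := fun i => not_disjoint_iff.1 (hF _ (hf i))
  choose a haf haS using h
  have : Function.Injective a := by
    intro i j hij
    by_contra hne
    exact disjoint_left.1 (hd i j hne) (haf i) (hij ▸ haf j)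
  have := card_le_card_of_injOn a (s := univ) (t := S) (fun i _ => haS i) this.injOn
  simp [hS] at this

/-- Remark after Theorem 1.2: for `n ≥ 4k²s` and `p ≥ n/k`, the maximum of
`p|ℬ₀| + |ℬ₁| + … + |ℬ_s|` over nested overlapping families of `k`-subsets of
`[n]` equals `(p+s)·(C(n,k) − C(n−s,k))`. -/
theorem stmt7 (k s p n : ℕ) (hk : 0 < k) (hs : 0 < s) (hp : 0 < p)
    (hn : 4 * k ^ 2 * s ≤ n) (hpk : (n : ℝ) / (k : ℝ) ≤ (p : ℝ)) :
    IsGreatest {x : ℕ | ∃ B : Fin (s + 1) → Finset (Finset (Fin n)),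
        (∀ i, ∀ A ∈ B i, A.card = k) ∧
        (∀ i j : Fin (s + 1), i ≤ j → B i ⊆ B j) ∧
        ¬ HasRainbowMatching B (s + 1) ∧
        x = p * (B 0).card + ∑ i : Fin s, (B i.succ).card}
      ((p + s) * (n.choose k - (n - s).choose k)) := by
  have hsn : s ≤ n := (Nat.le_mul_of_pos_left s (by positivity)).trans hn
  have hnp : n ≤ p * k := by
    rw [div_le_iff₀ (by exact_mod_cast hk)] at hpk
    exact_mod_cast hpk
  constructor
  · obtain ⟨S, -, hS⟩ := exists_subset_card_eq (s := (univ : Finset (Fin n))) (n := s) (by simpa)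
    refine ⟨fun _ => {A ∈ univ.powersetCard k | ¬ Disjoint A S}, fun i A hA => ?_,
      fun i j _ => Subset.rfl, ?_, ?_⟩
    · exact (mem_powersetCard.1 (mem_filter.1 hA).1).2
    · rw [hasRainbowMatching_iff_hasFullMatching]
      exact not_hasFullMatching_of_meets hS fun A hA => (mem_filter.1 hA).2
    · simp only [card_filter_not_disjoint_powersetCard, Fintype.card_fin, hS, sum_const,
        card_univ, smul_eq_mul]
      ring
  · rintro x ⟨B, hcard, hmono, hmat, rfl⟩
    rw [hasRainbowMatching_iff_hasFullMatching] at hmat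
    have h := nestedBound n hk s p univ B (by simpa) (by simpa)
      (fun i A hA => mem_powersetCard.2 ⟨subset_univ _, hcard i A hA⟩) hmono hmat
    have h' := coverCount_add_choose hk hsn
    rw [card_univ, Fintype.card_fin] at h
    rwa [← h', Nat.add_sub_cancel]
end

section
/- Let 𝒜₁, …, 𝒜_m be families of subsets of [n] = {1,…,n} and let 1 ≤ i < j ≤ m. If the sequence obtained from 𝒜₁,…,𝒜_m by replacing 𝒜_i with 𝒜_i ∩ 𝒜_j and 𝒜_j with 𝒜_i ∪ 𝒜_j admits a rainbow matching of size t, then 𝒜₁,…,𝒜_m also admits a rainbow matching of size t; consequently, ν(𝒜₁,…,𝒜_i∩𝒜_j,…,𝒜_i∪𝒜_j,…,𝒜_m) ≤ ν(𝒜₁,…,𝒜_m). -/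
/-- A rainbow matching amounts to a set of indices together with a choice of pairwise disjoint
members of the corresponding families. -/
theorem hasRainbowMatching_iff_exists_finset {α : Type*} [DecidableEq α] {m : ℕ}
    (𝒜 : Fin m → Finset (Finset α)) (t : ℕ) :
    HasRainbowMatching 𝒜 t ↔ ∃ (S : Finset (Fin m)) (F : Fin m → Finset α),
      S.card = t ∧ (∀ a ∈ S, F a ∈ 𝒜 a) ∧
      ∀ a ∈ S, ∀ b ∈ S, a ≠ b → Disjoint (F a) (F b) := by
  constructor
  · rintro ⟨idx, f, hidx, hf, hd⟩
    have hF : ∀ a, Function.extend idx f (fun _ => ∅) (idx a) = f a :=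
      fun a => hidx.injective.extend_apply f _ a
    refine ⟨Finset.univ.map ⟨idx, hidx.injective⟩, Function.extend idx f (fun _ => ∅),
      by simp, ?_, ?_⟩
    · simpa [hF] using hf
    · simpa [hF, hidx.injective.eq_iff] using hd
  · rintro ⟨S, F, hS, hF, hd⟩
    exact ⟨S.orderEmbOfFin hS, fun a => F (S.orderEmbOfFin hS a),
      (S.orderEmbOfFin hS).strictMono, fun a => hF _ (S.orderEmbOfFin_mem hS a),
      fun a b hab => hd _ (S.orderEmbOfFin_mem hS a) _ (S.orderEmbOfFin_mem hS b)
        ((S.orderEmbOfFin hS).injective.ne hab)⟩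

theorem HasRainbowMatching.le {α : Type*} [DecidableEq α] {m : ℕ}
    {𝒜 : Fin m → Finset (Finset α)} {t : ℕ} (h : HasRainbowMatching 𝒜 t) : t ≤ m := by
  obtain ⟨idx, _, hidx, _⟩ := h
  simpa using Fintype.card_le_of_injective idx hidx.injective

theorem hasRainbowMatching_zero {α : Type*} [DecidableEq α] {m : ℕ}
    (𝒜 : Fin m → Finset (Finset α)) : HasRainbowMatching 𝒜 0 :=
  ⟨Fin.elim0, Fin.elim0, fun a => a.elim0, fun a => a.elim0, fun a => a.elim0⟩

theorem HasRainbowMatching.of_update_inter_union {α : Type*} [DecidableEq α] {m : ℕ}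
    {𝒜 : Fin m → Finset (Finset α)} {i j : Fin m} (hij : i ≠ j) {t : ℕ}
    (h : HasRainbowMatching
      (Function.update (Function.update 𝒜 i (𝒜 i ∩ 𝒜 j)) j (𝒜 i ∪ 𝒜 j)) t) :
    HasRainbowMatching 𝒜 t := by
  rw [hasRainbowMatching_iff_exists_finset] at h ⊢
  obtain ⟨S, F, hS, hF, hd⟩ := h
  have hi : i ∈ S → F i ∈ 𝒜 i ∧ F i ∈ 𝒜 j := fun h => by simpa [hij] using hF i h
  have hj : j ∈ S → F j ∈ 𝒜 i ∨ F j ∈ 𝒜 j := fun h => by simpa using hF j h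
  have hne : ∀ a ∈ S, a ≠ i → a ≠ j → F a ∈ 𝒜 a := fun a h hai haj => by
    simpa [hai, haj] using hF a h
  by_cases hkeep : j ∈ S → F j ∈ 𝒜 j
  · refine ⟨S, F, hS, fun a ha => ?_, hd⟩
    by_cases hai : a = i
    · subst hai; exact (hi ha).1
    by_cases haj : a = j
    · subst haj; exact hkeep ha
    exact hne a ha hai haj
  · have hji : F j ∈ 𝒜 i := by tauto
    have hmem : ∀ a, a ∈ S.map (Equiv.swap i j).toEmbedding ↔ Equiv.swap i j a ∈ S := fun a => by
      rw [Finset.mem_map_equiv, Equiv.symm_swap]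
    refine ⟨S.map (Equiv.swap i j).toEmbedding, fun a => F (Equiv.swap i j a), by simpa using hS,
      fun a ha => ?_, fun a ha b hb hab => hd _ ((hmem a).1 ha) _ ((hmem b).1 hb)
        ((Equiv.swap i j).injective.ne hab)⟩
    rw [hmem] at ha
    beta_reduce
    by_cases hai : a = i
    · subst hai; simpa using hji
    by_cases haj : a = j
    · subst haj
      rw [Equiv.swap_apply_right] at ha ⊢
      exact (hi ha).2
    rw [Equiv.swap_apply_of_ne_of_ne hai haj] at ha ⊢
    exact hne a ha hai haj

/-- Observation 1: replacing `𝒜ᵢ, 𝒜ⱼ` by `𝒜ᵢ ∩ 𝒜ⱼ, 𝒜ᵢ ∪ 𝒜ⱼ` cannot increase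
the rainbow matching number: any rainbow matching of size `t` of the new
sequence gives one of the old sequence, so `ν(new) ≤ ν(old)`. -/
theorem stmt8 (n m : ℕ) (𝒜 : Fin m → Finset (Finset (Fin n)))
    (i j : Fin m) (hij : i < j) :
    (∀ t : ℕ, HasRainbowMatching
        (Function.update (Function.update 𝒜 i (𝒜 i ∩ 𝒜 j)) j (𝒜 i ∪ 𝒜 j)) t →
      HasRainbowMatching 𝒜 t) ∧
    sSup {t : ℕ | HasRainbowMatching
        (Function.update (Function.update 𝒜 i (𝒜 i ∩ 𝒜 j)) j (𝒜 i ∪ 𝒜 j)) t} ≤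
      sSup {t : ℕ | HasRainbowMatching 𝒜 t} := by
  have key : ∀ t : ℕ, HasRainbowMatching
        (Function.update (Function.update 𝒜 i (𝒜 i ∩ 𝒜 j)) j (𝒜 i ∪ 𝒜 j)) t →
      HasRainbowMatching 𝒜 t := fun _ h => h.of_update_inter_union hij.ne
  exact ⟨key, csSup_le_csSup ⟨m, fun _ h => HasRainbowMatching.le h⟩
    ⟨0, hasRainbowMatching_zero _⟩ key⟩
end

section
/- Let 𝒜₁ ⊆ 𝒜₂ ⊆ … ⊆ 𝒜_m be nested families of subsets of [n] = {1,…,n} with m ≥ s+1 and ν(𝒜₁,…,𝒜_m) ≤ s. Then the sequence of m families consisting of m−s copies of 𝒜_{m−s} followed by 𝒜_{m−s+1}, …, 𝒜_m also has rainbow matching number at most s. -/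
/-- Entries of a strictly increasing sequence in `Fin m` leave room above them for all
later entries. -/
theorem StrictMono.fin_val_add_sub_le {t m : ℕ} {g : Fin t → Fin m} (hg : StrictMono g)
    (a : Fin t) : t - 1 - a ≤ m - 1 - g a := by
  rw [← Fin.card_Ioi, ← Fin.card_Ioi]
  refine Finset.card_le_card_of_injOn g (fun b hb => ?_) hg.injective.injOn
  simpa using hg (by simpa using hb)

/-- Observation 2: if `𝒜₁ ⊆ … ⊆ 𝒜_m` are nested with rainbow matching number
at most `s`, then so is the sequence consisting of `m − s` copies of `𝒜_{m−s}`
followed by `𝒜_{m−s+1}, …, 𝒜_m`.  (Indices are 0-based: `𝒜_{m−s}` is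
`𝒜 ⟨m − s − 1⟩`, and the entries with index `< m − s` are replaced by it.) -/
theorem stmt9 (n m s : ℕ) (hs : 0 < s) (hm : s + 1 ≤ m)
    (𝒜 : Fin m → Finset (Finset (Fin n)))
    (hnested : ∀ i j : Fin m, i ≤ j → 𝒜 i ⊆ 𝒜 j)
    (hover : ¬ HasRainbowMatching 𝒜 (s + 1)) :
    ¬ HasRainbowMatching
      (fun i : Fin m =>
        if (i : ℕ) < m - s then 𝒜 ⟨m - s - 1, by omega⟩ else 𝒜 i)
      (s + 1) := by
  rintro ⟨idx, f, hidx, hf, hdisj⟩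
  refine hover ⟨fun a => ⟨m - s - 1 + a, by omega⟩, f, fun a b hab => ?_, fun a => ?_, hdisj⟩
  · simpa using hab
  · have hle := hidx.fin_val_add_sub_le a
    have hfa := hf a
    dsimp only at hfa
    split_ifs at hfa with h
    · exact hnested _ _ (Fin.mk_le_mk.2 (by omega)) hfa
    · exact hnested _ _ (Fin.le_def.2 (by dsimp only; omega)) hfa
end

section
/- Let k, s, p be positive integers and n ≥ (p+s)k. Then the maximum of p·|ℬ₀| + |ℬ₁| + … + |ℬ_s| over all nested overlapping sequences ℬ₀ ⊆ ℬ₁ ⊆ … ⊆ ℬ_s of families of k-element subsets of [n] = {1,…,n} equals s·C(n,k), where C(a,b) denotes the binomial coefficient. -/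
/-- Two finsets of equal size in a finite type are related by a permutation. -/
theorem exists_perm_map_eq_of_card_eq {α : Type*} [Fintype α] [DecidableEq α]
    {S T : Finset α} (h : S.card = T.card) :
    ∃ τ : Equiv.Perm α, S.map τ.toEmbedding = T := by
  let e : {x // x ∈ S} ≃ {x // x ∈ T} := Finset.equivOfCardEq h
  refine ⟨e.extendSubtype, Finset.eq_of_subset_of_card_le ?_ ?_⟩
  · intro y hy
    obtain ⟨x, hx, rfl⟩ := Finset.mem_map.1 hy
    exact e.extendSubtype_mem x hx
  · rw [Finset.card_map, h]

/-- The number of permutations carrying `T` to `A` depends only on the size of `A`. -/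
theorem card_perm_map_eq_const {α : Type*} [Fintype α] [DecidableEq α]
    (T : Finset α) {A A' : Finset α} (h : A.card = A'.card) :
    (Finset.univ.filter fun σ : Equiv.Perm α => T.map σ.toEmbedding = A).card =
      (Finset.univ.filter fun σ : Equiv.Perm α => T.map σ.toEmbedding = A').card := by
  obtain ⟨τ, rfl⟩ := exists_perm_map_eq_of_card_eq h
  refine Finset.card_equiv (Equiv.mulLeft τ) fun σ => ?_
  have key : T.map (τ * σ).toEmbedding = (T.map σ.toEmbedding).map τ.toEmbedding := by
    rw [Finset.map_map]; rfl
  simp only [Finset.mem_filter, Finset.mem_univ, true_and, Equiv.coe_mulLeft, key,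
    Finset.map_inj]

/-- The number of permutations carrying `T` into a family `B`. -/
theorem card_perm_map_mem {α : Type*} [Fintype α] [DecidableEq α]
    (T : Finset α) (B : Finset (Finset α)) :
    (Finset.univ.filter fun σ : Equiv.Perm α => T.map σ.toEmbedding ∈ B).card =
      ∑ A ∈ B, (Finset.univ.filter fun σ : Equiv.Perm α => T.map σ.toEmbedding = A).card := by
  rw [Finset.card_eq_sum_card_fiberwise (t := B) (f := fun σ => T.map σ.toEmbedding)]
  · refine Finset.sum_congr rfl fun A hA => ?_
    congr 1
    ext σ
    simp only [Finset.mem_filter, Finset.mem_univ, true_and, and_iff_right_iff_imp]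
    rintro rfl
    exact hA
  · intro σ hσ
    simpa using hσ

/-- A uniformly random image of a `k`-set lies in the `k`-uniform family `B` with
probability `|B| / C(n,k)`. -/
theorem choose_mul_card_perm_map_mem_s12 {α : Type*} [Fintype α] [DecidableEq α] {k : ℕ}
    {T : Finset α} (hT : T.card = k) {B : Finset (Finset α)} (hB : ∀ A ∈ B, A.card = k) :
    (Fintype.card α).choose k *
      (Finset.univ.filter fun σ : Equiv.Perm α => T.map σ.toEmbedding ∈ B).card =
      B.card * Fintype.card (Equiv.Perm α) := by
  set N := (Finset.univ.filter fun σ : Equiv.Perm α => T.map σ.toEmbedding = T).card with hN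
  have count : ∀ C : Finset (Finset α), (∀ A ∈ C, A.card = k) →
      (Finset.univ.filter fun σ : Equiv.Perm α => T.map σ.toEmbedding ∈ C).card =
        C.card * N := by
    intro C hC
    rw [card_perm_map_mem, Finset.sum_const_nat]
    intro A hA
    exact card_perm_map_eq_const T ((hC A hA).trans hT.symm)
  have total := count (Finset.powersetCard k Finset.univ)
    fun A hA => (Finset.mem_powersetCard.1 hA).2
  have hall : (Finset.univ.filter fun σ : Equiv.Perm α =>
      T.map σ.toEmbedding ∈ Finset.powersetCard k Finset.univ) = Finset.univ := by
    refine Finset.filter_true_of_mem fun σ _ => ?_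
    simp [Finset.mem_powersetCard, hT]
  rw [hall, Finset.card_powersetCard, Finset.card_univ, Finset.card_univ] at total
  rw [count B hB, total]
  ring

/-- A sequence of finsets whose `i`-th term has more than `i` elements has a
system of distinct representatives. -/
theorem exists_injective_mem_of_lt_card {ι : Type*} [DecidableEq ι] {m : ℕ}
    {t : Fin m → Finset ι} (hcard : ∀ i : Fin m, (i : ℕ) < (t i).card) :
    ∃ f : Fin m → ι, Function.Injective f ∧ ∀ i, f i ∈ t i := by
  refine (Finset.all_card_le_biUnion_card_iff_exists_injective t).1 fun S => ?_
  rcases S.eq_empty_or_nonempty with rfl | hS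
  · simp
  have h1 : S ⊆ Finset.Iic (S.max' hS) := fun i hi => Finset.mem_Iic.2 (S.le_max' i hi)
  have h2 := Finset.card_le_card h1
  rw [Fin.card_Iic] at h2
  have h3 := Finset.card_le_card (Finset.subset_biUnion_of_mem t (S.max'_mem hS))
  have h4 := hcard (S.max' hS)
  omega

/-- The weighted bound inside a fixed matching of size `p + s`. -/
theorem weighted_sum_le_of_card_le {p s : ℕ} {b : Fin (s + 1) → ℕ} (hb : Monotone b)
    (hle : ∀ i, b i ≤ p + s) {i : Fin (s + 1)} (hi : b i ≤ i) :
    p * b 0 + ∑ j : Fin s, b j.succ ≤ s * (p + s) := by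
  have his : (i : ℕ) ≤ s := Nat.lt_succ_iff.1 i.2
  have h0 : b 0 ≤ i := (hb (Fin.zero_le i)).trans hi
  have hsum : ∑ j : Fin s, b j.succ ≤ ∑ j : Fin s, if (j : ℕ) < i then (i : ℕ) else p + s := by
    refine Finset.sum_le_sum fun j _ => ?_
    split_ifs with h
    · refine (hb ?_).trans hi
      rw [Fin.le_def, Fin.val_succ]
      exact h
    · exact hle _
  rw [Fin.sum_univ_eq_sum_range (fun j => if j < (i : ℕ) then (i : ℕ) else p + s) s] at hsum
  obtain ⟨d, hd⟩ := Nat.exists_eq_add_of_le his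
  have heval : ∑ j ∈ Finset.range s, (if j < (i : ℕ) then (i : ℕ) else p + s) =
      i * i + d * (p + s) := by
    have hrange : Finset.range s = Finset.range (i + d) := by rw [← hd]
    rw [hrange, Finset.sum_range_add]
    congr 1
    · rw [Finset.sum_congr rfl fun j hj => if_pos (Finset.mem_range.1 hj)]
      simp
    · simp
  rw [heval] at hsum
  have h1 : p * b 0 ≤ p * i := Nat.mul_le_mul_left p h0
  have h2 : (i : ℕ) * (p + i) ≤ i * (p + s) := Nat.mul_le_mul_left _ (by omega)
  have h3 : s * (p + s) = i * (p + s) + d * (p + s) := by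
    rw [← add_mul, ← hd]
  nlinarith

/-- There are `m` pairwise disjoint `k`-subsets of `Fin n` as soon as `m * k ≤ n`. -/
theorem exists_pairwise_disjoint_card_eq {m k n : ℕ} (h : m * k ≤ n) :
    ∃ T : Fin m → Finset (Fin n),
      (∀ j, (T j).card = k) ∧ ∀ a b, a ≠ b → Disjoint (T a) (T b) := by
  let e : Fin m × Fin k ↪ Fin n :=
    finProdFinEquiv.toEmbedding.trans (Fin.castLEEmb h)
  refine ⟨fun j => (({j} : Finset (Fin m)) ×ˢ Finset.univ).map e, fun j => by simp,
    fun a b hab => ?_⟩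
  rw [Finset.disjoint_map, Finset.disjoint_product]
  left
  simpa using hab

/-- If a nested overlapping sequence is restricted to `p + s` pairwise disjoint sets, the
weighted number of members is at most `s * (p + s)`. -/
theorem weighted_card_le_of_not_hasRainbowMatching {α : Type*} [DecidableEq α] {p s : ℕ}
    {B : Fin (s + 1) → Finset (Finset α)} (hmono : Monotone B)
    (hB : ¬ HasRainbowMatching B (s + 1)) (T : Fin (p + s) → Finset α)
    (hT : ∀ a b, a ≠ b → Disjoint (T a) (T b)) :
    p * (Finset.univ.filter fun j => T j ∈ B 0).card +
      ∑ i : Fin s, (Finset.univ.filter fun j => T j ∈ B i.succ).card ≤ s * (p + s) := by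
  have ht : Monotone fun i => Finset.univ.filter fun j => T j ∈ B i := fun i i' h =>
    Finset.monotone_filter_right _ fun j _ hj => hmono h hj
  have hex : ∃ i : Fin (s + 1), (Finset.univ.filter fun j => T j ∈ B i).card ≤ i := by
    by_contra! hcon
    obtain ⟨f, hf, hmem⟩ := exists_injective_mem_of_lt_card hcon
    exact hB ⟨id, fun i => T (f i), strictMono_id, fun i => (Finset.mem_filter.1 (hmem i)).2,
      fun a b hab => hT _ _ (hf.ne hab)⟩
  obtain ⟨i, hi⟩ := hex
  refine weighted_sum_le_of_card_le (b := fun i => (Finset.univ.filter fun j => T j ∈ B i).card)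
    (fun i i' h => Finset.card_le_card (ht h)) (fun i => ?_) hi
  exact (Finset.card_le_univ _).trans_eq (Fintype.card_fin _)

/-- Double counting of pairs of a permutation and a set of the matching sent into `B`. -/
theorem choose_mul_sum_card_map_mem {α : Type*} [Fintype α] [DecidableEq α] {m k : ℕ}
    {T : Fin m → Finset α} (hT : ∀ j, (T j).card = k) {B : Finset (Finset α)}
    (hB : ∀ A ∈ B, A.card = k) :
    (Fintype.card α).choose k * ∑ σ : Equiv.Perm α,
        (Finset.univ.filter fun j => (T j).map σ.toEmbedding ∈ B).card =
      m * (B.card * Fintype.card (Equiv.Perm α)) := by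
  simp_rw [Finset.card_filter]
  rw [Finset.sum_comm, Finset.mul_sum]
  simp_rw [← Finset.card_filter]
  rw [Finset.sum_congr rfl fun j _ => choose_mul_card_perm_map_mem_s12 (hT j) hB]
  simp

/-- For `n ≥ (p+s)k`, the maximum of `p|ℬ₀| + |ℬ₁| + … + |ℬ_s|` over nested
overlapping families of `k`-subsets of `[n]` equals `s·C(n,k)`. -/
theorem stmt12 (k s p n : ℕ) (hk : 0 < k) (hs : 0 < s) (hp : 0 < p)
    (hn : (p + s) * k ≤ n) :
    IsGreatest {x : ℕ | ∃ B : Fin (s + 1) → Finset (Finset (Fin n)),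
        (∀ i, ∀ A ∈ B i, A.card = k) ∧
        (∀ i j : Fin (s + 1), i ≤ j → B i ⊆ B j) ∧
        ¬ HasRainbowMatching B (s + 1) ∧
        x = p * (B 0).card + ∑ i : Fin s, (B i.succ).card}
      (s * n.choose k) := by
  constructor
  · refine ⟨fun i => if i = 0 then ∅ else Finset.powersetCard k Finset.univ, ?_, ?_, ?_, ?_⟩
    · intro i A hA
      dsimp only at hA
      split_ifs at hA
      · simp at hA
      · exact (Finset.mem_powersetCard.1 hA).2
    · intro i j hij
      dsimp only
      split_ifs with hi hj hj
      · exact subset_rfl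
      · exact Finset.empty_subset _
      · exact absurd (Fin.le_zero_iff.1 (hj ▸ hij)) hi
      · exact subset_rfl
    · rintro ⟨idx, f, hidx, hf, -⟩
      obtain ⟨a, ha⟩ := Finite.surjective_of_injective hidx.injective 0
      have := hf a
      simp [ha] at this
    · simp [Fin.succ_ne_zero]
  · rintro x ⟨B, hcard, hmono, hB, rfl⟩
    obtain ⟨T, hTcard, hT⟩ := exists_pairwise_disjoint_card_eq hn
    have hσ : ∀ σ : Equiv.Perm (Fin n), _ := fun σ =>
      weighted_card_le_of_not_hasRainbowMatching (p := p) (fun i j h => hmono i j h) hB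
        (fun j => (T j).map σ.toEmbedding)
        fun a b hab => (Finset.disjoint_map _).2 (hT a b hab)
    have hsum := Finset.sum_le_sum fun σ (_ : σ ∈ Finset.univ) => hσ σ
    rw [Finset.sum_add_distrib, ← Finset.mul_sum, Finset.sum_comm, Finset.sum_const,
      Finset.card_univ, smul_eq_mul] at hsum
    have hmul := Nat.mul_le_mul_left (n.choose k) hsum
    have hcount : ∀ i, n.choose k * ∑ σ : Equiv.Perm (Fin n),
        (Finset.univ.filter fun j => (T j).map σ.toEmbedding ∈ B i).card =
          (p + s) * ((B i).card * Fintype.card (Equiv.Perm (Fin n))) := fun i => by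
      simpa only [Fintype.card_fin] using choose_mul_sum_card_map_mem hTcard (hcard i)
    rw [mul_add, mul_left_comm, hcount, Finset.mul_sum,
      Finset.sum_congr rfl fun i _ => hcount (Fin.succ i), ← Finset.mul_sum,
      ← Finset.sum_mul] at hmul
    have hpos : 0 < (p + s) * Fintype.card (Equiv.Perm (Fin n)) :=
      Nat.mul_pos (by omega) Fintype.card_pos
    refine Nat.le_of_mul_le_mul_left ?_ hpos
    linarith
end

section
/- Let ℬ₁, …, ℬ_t be shifted families of k-element subsets of [n] = {1,…,n} with n ≥ kt. If there exist pairwise disjoint sets B₁ ∈ ℬ₁, …, B_t ∈ ℬ_t, then there exist pairwise disjoint sets B₁' ∈ ℬ₁, …, B_t' ∈ ℬ_t with B₁' ∪ … ∪ B_t' ⊆ [kt] = {1,…,kt}. -/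
/-- The shifting partial order on finite sets of a linearly ordered type:
`G ≺ F` iff, listing both sets in increasing order, `G` and `F` have the same
size and each element of `G` is at most the corresponding element of `F`. -/
def ShiftLE {α : Type*} [LinearOrder α] (G F : Finset α) : Prop :=
  List.Forall₂ (· ≤ ·) (G.sort (· ≤ ·)) (F.sort (· ≤ ·))

/-- A family `ℱ` is shifted if `G ≺ F ∈ ℱ` always implies `G ∈ ℱ`. -/
def IsShiftedFamily {α : Type*} [LinearOrder α] (ℱ : Finset (Finset α)) : Prop :=
  ∀ F ∈ ℱ, ∀ G : Finset α, ShiftLE G F → G ∈ ℱ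

/-- The image of a finite set under a strictly increasing map that moves no element up is below the
set in the shifting order. -/
theorem shiftLE_image {α : Type*} [LinearOrder α] {g : α → α} {s : Finset α}
    (hg : StrictMonoOn g s) (hle : ∀ x ∈ s, g x ≤ x) : ShiftLE (s.image g) s := by
  have hsort : (s.image g).sort (· ≤ ·) = (s.sort (· ≤ ·)).map g := by
    have hlt : ((s.sort (· ≤ ·)).map g).Pairwise (· < ·) := by
      rw [List.pairwise_map]
      refine (Finset.sortedLT_sort s).pairwise.imp_of_mem fun ha hb hab => ?_
      exact hg (by simpa using ha) (by simpa using hb) hab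
    have himage : s.image g = ((s.sort (· ≤ ·)).map g).toFinset := by
      ext y
      simp
    rw [himage]
    exact (List.toFinset_sort (· ≤ ·) (hlt.imp ne_of_lt)).2 (hlt.imp le_of_lt)
  rw [ShiftLE, hsort, List.forall₂_map_left_iff, List.forall₂_same]
  intro x hx
  exact hle x (by simpa using hx)

/-- The rank of `x` in `U`, i.e. the number of elements of `U` below `x`, is at most `x`. -/
theorem card_filter_lt_le {n : ℕ} (U : Finset (Fin n)) (x : Fin n) :
    (U.filter (· < x)).card ≤ (x : ℕ) := by
  calc (U.filter (· < x)).card ≤ (Finset.Iio x).card :=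
        Finset.card_le_card fun y hy => by simpa using (Finset.mem_filter.1 hy).2
    _ = x := Fin.card_Iio x

/-- The rank function of a finite set is strictly increasing on it. -/
theorem card_filter_lt_strictMonoOn {α : Type*} [LinearOrder α] (U : Finset α) :
    StrictMonoOn (fun x => (U.filter (· < x)).card) (U : Set α) := by
  intro x hx y _ hxy
  refine Finset.card_lt_card (Finset.ssubset_iff_of_subset ?_ |>.2 ⟨x, ?_, ?_⟩)
  · intro z hz
    rw [Finset.mem_filter] at hz ⊢
    exact ⟨hz.1, hz.2.trans hxy⟩
  · exact Finset.mem_filter.2 ⟨hx, hxy⟩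
  · simp

/-- If `ℬ₁, …, ℬ_t` are shifted families of `k`-subsets of `[n]` (modelled by
`Fin n`), `n ≥ kt`, and they admit pairwise disjoint representatives, then they
admit pairwise disjoint representatives inside the first `kt` elements. -/
theorem stmt14 (n k t : ℕ) (hk : 0 < k) (ht : 0 < t) (hn : k * t ≤ n)
    (ℬ : Fin t → Finset (Finset (Fin n)))
    (hunif : ∀ a, ∀ F ∈ ℬ a, F.card = k)
    (hshift : ∀ a, IsShiftedFamily (ℬ a))
    (B : Fin t → Finset (Fin n)) (hB : ∀ a, B a ∈ ℬ a)
    (hdisj : ∀ a b, a ≠ b → Disjoint (B a) (B b)) :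
    ∃ B' : Fin t → Finset (Fin n),
      (∀ a, B' a ∈ ℬ a) ∧
      (∀ a b, a ≠ b → Disjoint (B' a) (B' b)) ∧
      ∀ a, ∀ x ∈ B' a, (x : ℕ) < k * t := by
  set U : Finset (Fin n) := Finset.univ.biUnion B with hU
  have hBU : ∀ a, B a ⊆ U := fun a => Finset.subset_biUnion_of_mem B (Finset.mem_univ a)
  have hcard : U.card = k * t := by
    rw [hU, Finset.card_biUnion fun a _ b _ hab => hdisj a b hab,
      Finset.sum_congr rfl fun a _ => hunif a (B a) (hB a)]
    simp [mul_comm]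
  let g : Fin n → Fin n := fun x =>
    ⟨(U.filter (· < x)).card, (card_filter_lt_le U x).trans_lt x.isLt⟩
  have hg : StrictMonoOn g U := fun x hx y hy hxy => card_filter_lt_strictMonoOn U hx hy hxy
  refine ⟨fun a => (B a).image g, fun a => ?_, fun a b hab => ?_, fun a y hy => ?_⟩
  · exact hshift a (B a) (hB a) _ (shiftLE_image (hg.mono (Finset.coe_subset.2 (hBU a)))
      fun x _ => card_filter_lt_le U x)
  · rw [Finset.disjoint_left]
    intro y hya hyb
    obtain ⟨x, hx, rfl⟩ := Finset.mem_image.1 hya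
    obtain ⟨z, hz, hzx⟩ := Finset.mem_image.1 hyb
    have hzx' : z = x := hg.injOn (hBU b hz) (hBU a hx) hzx
    exact Finset.disjoint_left.1 (hdisj a b hab) hx (hzx' ▸ hz)
  · obtain ⟨x, hx, rfl⟩ := Finset.mem_image.1 hy
    rw [← hcard]
    refine Finset.card_lt_card (Finset.ssubset_iff_of_subset (Finset.filter_subset _ _) |>.2
      ⟨x, hBU a hx, by simp⟩)
end
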